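/- Under the law μ_n, the self-adjusted temperature T_n converges in probability to 1 as n → ∞; that is, for every ε > 0, μ_n(|T_n − 1| > ε) → 0. -/

import Mathlib

open MeasureTheory ProbabilityTheory Real Filter Topology

noncomputable section

/-- The Hamiltonian of the model: each spin interacts with its `2r` nearest
neighbours on the discrete circle `ℤ/nℤ`. -/
def Ham (n r : ℕ) (x : Fin n → ℝ) : ℝ :=
  -(1 / (2 * (r : ℝ))) *
    ∑ i : Fin n, ∑ j ∈ Finset.Icc 1 r, x i * x ⟨((i : ℕ) + j) % n, Nat.mod_lt _ i.pos⟩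

/-- The self-adjusted temperature. -/
def Temp (n : ℕ) (x : Fin n → ℝ) : ℝ := (∑ i : Fin n, (x i) ^ 2) / n

/-- The magnetization. -/
def Mag (n : ℕ) (x : Fin n → ℝ) : ℝ := ∑ i : Fin n, x i

/-- The unnormalized measure `exp(-H_n/T_n) 1_{T_n>0} dν^{⊗n}`. -/
def preμ (n r : ℕ) : Measure (Fin n → ℝ) :=
  (Measure.pi fun _ : Fin n => (gaussianReal 0 1 : Measure ℝ)).withDensity
    fun x => if 0 < Temp n x then ENNReal.ofReal (Real.exp (-(Ham n r x) / Temp n x)) else 0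

/-- The probability measure `μ_n` of the model. -/
def μmeas (n r : ℕ) : Measure (Fin n → ℝ) := (preμ n r Set.univ)⁻¹ • preμ n r

/-- A product of functions of single coordinates can be integrated coordinatewise. -/
lemma lintegral_pi_prod_eval {ι : Type*} [Fintype ι] {α : ι → Type*}
    [∀ i, MeasurableSpace (α i)] (m : ∀ i, Measure (α i)) [∀ i, IsProbabilityMeasure (m i)]
    {f : ∀ i, α i → ENNReal} (hf : ∀ i, Measurable (f i)) :
    ∫⁻ x, ∏ i, f i (x i) ∂Measure.pi m = ∏ i, ∫⁻ y, f i y ∂m i := by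
  refine (lintegral_prod_eq_prod_lintegral_of_indepFun Finset.univ
    (fun i (x : ∀ j, α j) => f i (x i))
    (iIndepFun_pi fun i => (hf i).aemeasurable)
    (fun i => (hf i).comp (measurable_pi_apply i))).trans ?_
  refine Finset.prod_congr rfl fun i _ => ?_
  exact (measurePreserving_eval m i).lintegral_comp (hf i)

/-- A product of densities is the density of the product measure. -/
lemma pi_withDensity_eq {ι : Type*} [Fintype ι] {α : ι → Type*}
    [∀ i, MeasurableSpace (α i)] (m : ∀ i, Measure (α i)) [∀ i, IsProbabilityMeasure (m i)]
    {f : ∀ i, α i → ENNReal} (hf : ∀ i, Measurable (f i))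
    [∀ i, SigmaFinite ((m i).withDensity (f i))] :
    Measure.pi (fun i => (m i).withDensity (f i)) =
      (Measure.pi m).withDensity fun x => ∏ i, f i (x i) := by
  refine Measure.pi_eq fun s hs => ?_
  rw [withDensity_apply _ (MeasurableSet.univ_pi hs),
    ← lintegral_indicator (MeasurableSet.univ_pi hs)]
  have key : (Set.univ.pi s).indicator (fun x => ∏ i, f i (x i)) =
      fun x => ∏ i, (s i).indicator (f i) (x i) := by
    ext x
    by_cases hx : x ∈ Set.univ.pi s
    · rw [Set.indicator_of_mem hx]
      exact Finset.prod_congr rfl fun i _ =>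
        (Set.indicator_of_mem (hx i (Set.mem_univ i)) _).symm
    · rw [Set.indicator_of_notMem hx]
      simp only [Set.mem_pi, Set.mem_univ, forall_const, not_forall] at hx
      obtain ⟨i, hi⟩ := hx
      exact (Finset.prod_eq_zero (Finset.mem_univ i) (Set.indicator_of_notMem hi _)).symm
  rw [key, lintegral_pi_prod_eval m fun i => (hf i).indicator (hs i)]
  refine Finset.prod_congr rfl fun i _ => ?_
  rw [withDensity_apply _ (hs i), lintegral_indicator (hs i)]

/-- The density of the centred Gaussian of standard deviation `c` with respect to the standard
Gaussian. -/
def scaleDensity (c y : ℝ) : ℝ := c⁻¹ * rexp ((1 - (c ^ 2)⁻¹) / 2 * y ^ 2)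

lemma measurable_ofReal_scaleDensity (c : ℝ) :
    Measurable fun y => ENNReal.ofReal (scaleDensity c y) := by
  unfold scaleDensity
  fun_prop

lemma gaussianReal_map_mul_eq_withDensity {c : ℝ} (hc : 0 < c) :
    (gaussianReal 0 1).map (c * ·) =
      (gaussianReal 0 1).withDensity fun y => ENNReal.ofReal (scaleDensity c y) := by
  have hv : NNReal.mk (c ^ 2) (sq_nonneg _) * 1 ≠ 0 := by
    rw [mul_one]
    intro h
    exact (pow_pos hc 2).ne' (congrArg NNReal.toReal h)
  rw [gaussianReal_map_const_mul, mul_zero, gaussianReal_of_var_ne_zero _ hv,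
    gaussianReal_of_var_ne_zero _ one_ne_zero,
    ← withDensity_mul _ (measurable_gaussianPDF _ _) (measurable_ofReal_scaleDensity c)]
  congr 1
  ext y
  rw [Pi.mul_apply, gaussianPDF, gaussianPDF, ← ENNReal.ofReal_mul (gaussianPDFReal_nonneg _ _ _)]
  congr 1
  have hsqrt : √(2 * π * c ^ 2) = √(2 * π) * c := by
    rw [Real.sqrt_mul (by positivity), Real.sqrt_sq hc.le]
  simp only [gaussianPDFReal, scaleDensity, mul_one, NNReal.coe_one, NNReal.coe_mk, hsqrt,
    sub_zero, mul_inv]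
  rw [mul_mul_mul_comm, ← Real.exp_add]
  congr 2
  field_simp
  ring

/-- A function invariant under scaling has the same Gaussian integral after rescaling the
Gaussian measure. -/
lemma lintegral_scaleDensity_mul {n : ℕ} {c : ℝ} (hc : 0 < c) {F : (Fin n → ℝ) → ENNReal}
    (hF : Measurable F) (hinv : ∀ x, F (fun i => c * x i) = F x) :
    ∫⁻ x, (∏ i, ENNReal.ofReal (scaleDensity c (x i))) * F x
        ∂(Measure.pi fun _ : Fin n => gaussianReal 0 1) =
      ∫⁻ x, F x ∂(Measure.pi fun _ : Fin n => gaussianReal 0 1) := by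
  have hmeas : Measurable fun x : Fin n → ℝ => ∏ i, ENNReal.ofReal (scaleDensity c (x i)) :=
    Finset.measurable_prod _ fun i _ =>
      (measurable_ofReal_scaleDensity c).comp (measurable_pi_apply i)
  have hmap : (Measure.pi fun _ : Fin n => gaussianReal 0 1).map (fun x i => c * x i) =
      (Measure.pi fun _ : Fin n => gaussianReal 0 1).withDensity
        fun x => ∏ i, ENNReal.ofReal (scaleDensity c (x i)) := by
    have : SigmaFinite ((gaussianReal 0 1).map (c * ·)) := by
      rw [gaussianReal_map_const_mul]
      infer_instance
    rw [Measure.pi_map_pi (fun i => by fun_prop)]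
    simp only [gaussianReal_map_mul_eq_withDensity hc]
    exact pi_withDensity_eq _ fun _ => measurable_ofReal_scaleDensity c
  have h := lintegral_withDensity_eq_lintegral_mul
    (Measure.pi fun _ : Fin n => gaussianReal 0 1) hmeas hF
  simp only [Pi.mul_apply] at h
  rw [← h, ← hmap, lintegral_map hF (by fun_prop)]
  simp only [hinv]

lemma Temp_const_mul (n : ℕ) (c : ℝ) (x : Fin n → ℝ) :
    Temp n (fun i => c * x i) = c ^ 2 * Temp n x := by
  simp only [Temp, mul_pow, ← Finset.mul_sum, mul_div_assoc]

lemma Ham_const_mul (n r : ℕ) (c : ℝ) (x : Fin n → ℝ) :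
    Ham n r (fun i => c * x i) = c ^ 2 * Ham n r x := by
  simp only [Ham, mul_left_comm (c ^ 2), Finset.mul_sum]
  refine Finset.sum_congr rfl fun i _ => Finset.sum_congr rfl fun j _ => ?_
  ring

lemma measurable_Temp (n : ℕ) : Measurable (Temp n) := by
  unfold Temp
  fun_prop

lemma measurable_Ham (n r : ℕ) : Measurable (Ham n r) := by
  unfold Ham
  fun_prop

/-- The Gibbs weight of the model. -/
def gibbsWeight (n r : ℕ) (x : Fin n → ℝ) : ENNReal :=
  if 0 < Temp n x then ENNReal.ofReal (Real.exp (-(Ham n r x) / Temp n x)) else 0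

lemma measurable_gibbsWeight (n r : ℕ) : Measurable (gibbsWeight n r) := by
  have := measurable_Temp n
  have := measurable_Ham n r
  exact Measurable.ite (measurableSet_lt measurable_const (measurable_Temp n)) (by fun_prop)
    measurable_const

lemma gibbsWeight_const_mul (n r : ℕ) {c : ℝ} (hc : 0 < c) (x : Fin n → ℝ) :
    gibbsWeight n r (fun i => c * x i) = gibbsWeight n r x := by
  have hc2 : 0 < c ^ 2 := by positivity
  simp only [gibbsWeight, Temp_const_mul, Ham_const_mul, mul_pos_iff_of_pos_left hc2,
    ← mul_neg, mul_div_mul_left _ _ hc2.ne']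

/-- If `u` lies strictly between `1` and `a`, the exponential rate of the tail bound exceeds `1`. -/
lemma one_lt_tail_rate {a u : ℝ} (hu : 0 < u) (h : 0 < (u - 1) * (a - u)) :
    1 < (√u)⁻¹ * rexp ((1 - u⁻¹) / 2 * a) := by
  have hlog : Real.log u < (1 - u⁻¹) * a := by
    have h1 := Real.log_le_sub_one_of_pos hu
    have h2 : (1 - u⁻¹) * a - (u - 1) = (u - 1) * (a - u) / u := by
      field_simp
    have := div_pos h hu
    linarith
  rw [← Real.exp_log (inv_pos.2 (Real.sqrt_pos.2 hu)), ← Real.exp_add, Real.one_lt_exp_iff,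
    Real.log_inv, Real.log_sqrt hu.le]
  linarith

lemma pow_rate_le_prod_scaleDensity {n : ℕ} (hn : n ≠ 0) {a u : ℝ} (hu : 0 < u) {x : Fin n → ℝ}
    (hx : 0 ≤ (u - 1) * (Temp n x - a)) :
    ENNReal.ofReal ((√u)⁻¹ * rexp ((1 - u⁻¹) / 2 * a)) ^ n ≤
      ∏ i, ENNReal.ofReal (scaleDensity √u (x i)) := by
  have hn' : (n : ℝ) ≠ 0 := Nat.cast_ne_zero.2 hn
  have hsum : ∑ i, x i ^ 2 = n * Temp n x := by
    rw [Temp, mul_div_cancel₀ _ hn']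
  have hle : (1 - u⁻¹) / 2 * a ≤ (1 - u⁻¹) / 2 * Temp n x := by
    have h2 : (1 - u⁻¹) / 2 * Temp n x - (1 - u⁻¹) / 2 * a =
        (u - 1) * (Temp n x - a) / (2 * u) := by
      field_simp
    have : 0 ≤ (u - 1) * (Temp n x - a) / (2 * u) := by positivity
    linarith
  have hprod : ∏ i, scaleDensity √u (x i) =
      ((√u)⁻¹ * rexp ((1 - u⁻¹) / 2 * Temp n x)) ^ n := by
    simp only [scaleDensity, Real.sq_sqrt hu.le]
    rw [Finset.prod_mul_distrib, ← Real.exp_sum, ← Finset.mul_sum, hsum, mul_pow, ← Real.exp_nat_mul]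
    simp only [Finset.prod_const, Finset.card_univ, Fintype.card_fin]
    congr 2
    ring
  rw [← ENNReal.ofReal_prod_of_nonneg fun i _ => by unfold scaleDensity; positivity, hprod,
    ← ENNReal.ofReal_pow (by positivity)]
  gcongr

/-- Chernoff bound for the temperature; both tails are covered, depending on the sign of `u - 1`. -/
lemma rate_pow_mul_preμ_le {n : ℕ} (hn : n ≠ 0) (r : ℕ) {a u : ℝ} (hu : 0 < u) :
    ENNReal.ofReal ((√u)⁻¹ * rexp ((1 - u⁻¹) / 2 * a)) ^ n *
        preμ n r {x | 0 ≤ (u - 1) * (Temp n x - a)} ≤ preμ n r Set.univ := by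
  have hT := measurable_Temp n
  have hA : MeasurableSet {x | 0 ≤ (u - 1) * (Temp n x - a)} :=
    measurableSet_le measurable_const (by fun_prop)
  change _ * (Measure.withDensity _ (gibbsWeight n r)) _ ≤
    (Measure.withDensity _ (gibbsWeight n r)) _
  rw [withDensity_apply _ hA, withDensity_apply _ MeasurableSet.univ, Measure.restrict_univ,
    ← lintegral_const_mul _ (measurable_gibbsWeight n r),
    ← lintegral_scaleDensity_mul (Real.sqrt_pos.2 hu) (measurable_gibbsWeight n r)
      (gibbsWeight_const_mul n r (Real.sqrt_pos.2 hu))]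
  refine (setLIntegral_mono' hA fun x hx => ?_).trans (setLIntegral_le_lintegral _ _)
  exact mul_le_mul_left (pow_rate_le_prod_scaleDensity hn hu hx) _

lemma tendsto_μmeas_tail (r : ℕ → ℕ) {a u : ℝ} (hu : 0 < u) (h : 0 < (u - 1) * (a - u)) :
    Tendsto (fun n => μmeas n (r n) {x | 0 ≤ (u - 1) * (Temp n x - a)}) atTop (𝓝 0) := by
  set b : ENNReal := ENNReal.ofReal ((√u)⁻¹ * rexp ((1 - u⁻¹) / 2 * a)) with hb
  have hb1 : 1 < b := by
    rw [hb, ENNReal.one_lt_ofReal]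
    exact one_lt_tail_rate hu h
  refine tendsto_of_tendsto_of_tendsto_of_le_of_le' tendsto_const_nhds
    (ENNReal.tendsto_pow_atTop_nhds_zero_of_lt_one (ENNReal.inv_lt_one.2 hb1))
    (Eventually.of_forall fun _ => zero_le) ?_
  filter_upwards [eventually_ne_atTop 0] with n hn
  have hbn0 : b ^ n ≠ 0 := pow_ne_zero _ (zero_lt_one.trans hb1).ne'
  have hbnt : b ^ n ≠ ⊤ := ENNReal.pow_ne_top ENNReal.ofReal_ne_top
  rw [← ENNReal.inv_pow, μmeas, Measure.smul_apply, smul_eq_mul]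
  calc (preμ n (r n) Set.univ)⁻¹ * preμ n (r n) {x | 0 ≤ (u - 1) * (Temp n x - a)}
      ≤ (preμ n (r n) Set.univ)⁻¹ * ((b ^ n)⁻¹ * preμ n (r n) Set.univ) := by
        gcongr
        rw [← ENNReal.mul_le_iff_le_inv hbn0 hbnt]
        exact rate_pow_mul_preμ_le hn (r n) hu
    _ = (b ^ n)⁻¹ * ((preμ n (r n) Set.univ)⁻¹ * preμ n (r n) Set.univ) := mul_left_comm _ _ _
    _ ≤ (b ^ n)⁻¹ := mul_le_of_le_one_right' (ENNReal.inv_mul_le_one _)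

/-- **Corollary (temperature concentration).** Under `μ_n`, the self-adjusted temperature
`T_n` converges in probability to `1`: for every `ε > 0`,
`μ_n(|T_n − 1| > ε) → 0` as `n → ∞`. -/
theorem temperature_tendsto_one_in_probability
    (r : ℕ → ℕ) (hr : ∀ n, 3 ≤ n → 0 < 2 * r n ∧ 2 * r n < n) :
    ∀ ε : ℝ, 0 < ε →
      Tendsto (fun n : ℕ => μmeas n (r n) {x | ε < |Temp n x - 1|}) atTop (𝓝 0) := by
  intro ε hε
  obtain ⟨δ, hδ, hδε, hδ1⟩ : ∃ δ : ℝ, 0 < δ ∧ δ ≤ ε ∧ δ ≤ 1 :=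
    ⟨min ε 1, by positivity, min_le_left _ _, min_le_right _ _⟩
  have hup := tendsto_μmeas_tail r (a := 1 + δ) (u := 1 + δ / 2) (by positivity)
    (by ring_nf; positivity)
  have hlo := tendsto_μmeas_tail r (a := 1 - δ) (u := 1 - δ / 2) (by linarith)
    (by ring_nf; positivity)
  have hsum := hup.add hlo
  rw [add_zero] at hsum
  refine tendsto_of_tendsto_of_tendsto_of_le_of_le tendsto_const_nhds hsum
    (fun _ => zero_le) fun n => (measure_mono fun x hx => ?_).trans (measure_union_le _ _)
  rcases lt_abs.1 (show ε < |Temp n x - 1| from hx) with h | h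
  · left
    change 0 ≤ (1 + δ / 2 - 1) * (Temp n x - (1 + δ))
    exact mul_nonneg (by linarith) (by linarith)
  · right
    change 0 ≤ (1 - δ / 2 - 1) * (Temp n x - (1 - δ))
    exact mul_nonneg_of_nonpos_of_nonpos (by linarith) (by linarith)

end
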